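/- Let 0 < e_0 ≤ 1 and m ≥ 2. For i ∈ Fin m with i < m − 1 let A_i : ℝ → ℝ satisfy A_i(0) = 0 and e_0·(t − s) ≤ A_i(t) − A_i(s) ≤ t − s for all 0 ≤ s ≤ t; for the last machine let A_{m−1} satisfy A_{m−1}(0) = 0, A_{m−1}(t) − A_{m−1}(s) ≤ t − s for 0 ≤ s ≤ t, A_{m−1} strictly increasing, and A_{m−1}(t) → ∞. Let g_i(w) = sInf {t ≥ 0 : A_i(t) ≥ w} and let p : Fin n → ℝ with p_j > 0. If σ : Fin n → Fin m is an ECT schedule for the order 1, …, n (for every job k and machine i, g_{σ k}(L_{σ k}^{<k}(σ) + p_k) ≤ g_i(L_i^{<k}(σ) + p_k), where L_i^{<k}(σ) = ∑_{j < k, σ j = i} p_j), then C_max(σ) ≤ (1 + 1/e_0)·C*, where C_max(σ) = max_i g_i(∑_{j : σ j = i} p_j) and C* is the minimum of C_max over all assignments. -/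

import Mathlib

noncomputable def finish (A : ℝ → ℝ) (w : ℝ) : ℝ := sInf {t : ℝ | 0 ≤ t ∧ w ≤ A t}

noncomputable def load {n m : ℕ} (p : Fin n → ℝ) (σ : Fin n → Fin m) (i : Fin m) : ℝ :=
  ∑ j ∈ Finset.univ.filter (fun j => σ j = i), p j

noncomputable def prefLoad {n m : ℕ} (p : Fin n → ℝ) (σ : Fin n → Fin m) (i : Fin m)
    (k : Fin n) : ℝ :=
  ∑ j ∈ Finset.univ.filter (fun j => j < k ∧ σ j = i), p j

noncomputable def makespan {n m : ℕ} (hm : 0 < m) (A : Fin m → ℝ → ℝ) (p : Fin n → ℝ)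
    (σ : Fin n → Fin m) : ℝ :=
  Finset.univ.sup' ⟨⟨0, hm⟩, Finset.mem_univ _⟩ (fun i => finish (A i) (load p σ i))

noncomputable def optMakespan {n m : ℕ} (hm : 0 < m) (A : Fin m → ℝ → ℝ) (p : Fin n → ℝ) : ℝ :=
  Finset.univ.inf' ⟨fun _ => ⟨0, hm⟩, Finset.mem_univ _⟩ (makespan hm A p)

theorem finish_nonneg (A : ℝ → ℝ) (w : ℝ) : 0 ≤ finish A w :=
  Real.sInf_nonneg fun _ ht => ht.1

theorem finish_le {A : ℝ → ℝ} {w t : ℝ} (ht : 0 ≤ t) (hw : w ≤ A t) : finish A w ≤ t :=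
  csInf_le ⟨0, fun _ hx => hx.1⟩ ⟨ht, hw⟩

/-- A capacity function that is nondecreasing, unbounded and grows at rate at most one has
processed at least `w` by any time after the finish time of `w`. -/
theorem le_of_finish_le {A : ℝ → ℝ} {w t : ℝ}
    (hub : ∀ s t : ℝ, 0 ≤ s → s ≤ t → A t - A s ≤ t - s)
    (hmono : MonotoneOn A (Set.Ici 0)) (htop : Filter.Tendsto A Filter.atTop Filter.atTop)
    (h : finish A w ≤ t) : w ≤ A t := by
  have hne : {t : ℝ | 0 ≤ t ∧ w ≤ A t}.Nonempty :=
    ((Filter.eventually_ge_atTop 0).and (htop.eventually_ge_atTop w)).exists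
  have hf := finish_nonneg A w
  refine le_trans ?_ (hmono hf (hf.trans h) h)
  refine le_of_forall_pos_le_add fun ε hε => ?_
  obtain ⟨s, hs, hsε⟩ := exists_lt_of_csInf_lt hne (lt_add_of_pos_right (finish A w) hε)
  have := hub _ s hf (finish_le hs.1 hs.2)
  linarith [hs.2]

theorem sum_load {n m : ℕ} (p : Fin n → ℝ) (σ : Fin n → Fin m) :
    ∑ i, load p σ i = ∑ j, p j :=
  Finset.sum_fiberwise _ _ _

theorem sum_prefLoad {n m : ℕ} (p : Fin n → ℝ) (σ : Fin n → Fin m) (k : Fin n) :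
    ∑ i, prefLoad p σ i k = ∑ j ∈ Finset.univ.filter (· < k), p j := by
  simp only [prefLoad, ← Finset.filter_filter]
  exact Finset.sum_fiberwise _ _ _

theorem sum_prefLoad_add_le {n m : ℕ} {p : Fin n → ℝ} (hp : ∀ j, 0 ≤ p j)
    (σ : Fin n → Fin m) (k : Fin n) : ∑ i, prefLoad p σ i k + p k ≤ ∑ j, p j := by
  rw [sum_prefLoad, add_comm, ← Finset.sum_insert (by simp)]
  exact Finset.sum_le_sum_of_subset_of_nonneg (Finset.subset_univ _) fun j _ _ => hp j

theorem le_load {n m : ℕ} {p : Fin n → ℝ} (hp : ∀ j, 0 ≤ p j) (σ : Fin n → Fin m)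
    (k : Fin n) : p k ≤ load p σ (σ k) :=
  Finset.single_le_sum (f := p) (fun j _ => hp j) (by simp)

/-- The load of a machine is either zero or is completed by the last job assigned to it. -/
theorem load_eq_zero_or_eq_prefLoad_add {n m : ℕ} (p : Fin n → ℝ) (σ : Fin n → Fin m)
    (i : Fin m) : load p σ i = 0 ∨ ∃ k, σ k = i ∧ load p σ i = prefLoad p σ i k + p k := by
  rcases (Finset.univ.filter fun j => σ j = i).eq_empty_or_nonempty with h | h
  · exact .inl (by simp [load, h])
  · obtain ⟨k, hk, hmax⟩ := Finset.exists_max_image _ id h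
    have hki : σ k = i := by simpa using hk
    refine .inr ⟨k, hki, ?_⟩
    rw [load, prefLoad, add_comm, ← Finset.sum_insert (by simp)]
    congr 1
    ext j
    have := hmax j
    simp only [Finset.mem_filter, Finset.mem_univ, true_and, Finset.mem_insert, id] at this ⊢
    constructor
    · intro hj
      rcases (this hj).eq_or_lt with h | h
      · exact .inl h
      · exact .inr ⟨h, hj⟩
    · rintro (rfl | h)
      exacts [hki, h.2]

theorem stmt_9 (e0 : ℝ) (he0 : 0 < e0) (he0' : e0 ≤ 1)
    (m n : ℕ) (hm2 : 2 ≤ m)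
    (A : Fin m → ℝ → ℝ) (hA0 : ∀ i, A i 0 = 0)
    (hAub : ∀ i, ∀ s t : ℝ, 0 ≤ s → s ≤ t → A i t - A i s ≤ t - s)
    (hAlo : ∀ i : Fin m, (i : ℕ) < m - 1 →
      ∀ s t : ℝ, 0 ≤ s → s ≤ t → e0 * (t - s) ≤ A i t - A i s)
    (hmono : ∀ i : Fin m, (i : ℕ) = m - 1 → StrictMonoOn (A i) (Set.Ici (0 : ℝ)))
    (htop : ∀ i : Fin m, (i : ℕ) = m - 1 → Filter.Tendsto (A i) Filter.atTop Filter.atTop)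
    (p : Fin n → ℝ) (hp : ∀ j, 0 < p j)
    (σ : Fin n → Fin m)
    (hECT : ∀ k : Fin n, ∀ i : Fin m,
      finish (A (σ k)) (prefLoad p σ (σ k) k + p k) ≤ finish (A i) (prefLoad p σ i k + p k)) :
    makespan (by omega : 0 < m) A p σ
      ≤ (1 + 1 / e0) * optMakespan (by omega : 0 < m) A p := by
  have hm : 0 < m := by omega
  have hp' : ∀ j, 0 ≤ p j := fun j => (hp j).le
  have hlt : ∀ i : Fin m, (i : ℕ) ≠ m - 1 → (i : ℕ) < m - 1 := fun i hi => by omega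
  have hmonoOn : ∀ i, MonotoneOn (A i) (Set.Ici 0) := fun i => by
    by_cases hi : (i : ℕ) = m - 1
    · exact (hmono i hi).monotoneOn
    · intro s hs t _ hst
      have := hAlo i (hlt i hi) s t hs hst
      have := mul_nonneg he0.le (sub_nonneg.2 hst)
      linarith
  have htend : ∀ i, Filter.Tendsto (A i) Filter.atTop Filter.atTop := fun i => by
    by_cases hi : (i : ℕ) = m - 1
    · exact htop i hi
    · refine Filter.tendsto_atTop_mono' _ ?_ (Filter.tendsto_id.const_mul_atTop he0)
      filter_upwards [Filter.eventually_ge_atTop 0] with t ht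
      simpa [hA0] using hAlo i (hlt i hi) 0 t le_rfl ht
  obtain ⟨τ, -, hτ⟩ := Finset.exists_mem_eq_inf'
    (⟨fun _ => ⟨0, hm⟩, Finset.mem_univ _⟩ : (Finset.univ : Finset (Fin n → Fin m)).Nonempty)
    (makespan hm A p)
  change optMakespan hm A p = makespan hm A p τ at hτ
  set T := optMakespan hm A p
  have hfin : ∀ i, finish (A i) (load p τ i) ≤ T := fun i => hτ ▸
    Finset.le_sup' (fun i => finish (A i) (load p τ i)) (Finset.mem_univ i)
  have hload : ∀ i, load p τ i ≤ A i T := fun i =>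
    le_of_finish_le (hAub i) (hmonoOn i) (htend i) (hfin i)
  have hT : 0 ≤ T := (finish_nonneg _ _).trans (hfin ⟨0, hm⟩)
  have hpT : ∀ k, p k ≤ T := fun k => by
    have := hAub (τ k) 0 T le_rfl hT
    linarith [le_load hp' τ k, hload (τ k), hA0 (τ k)]
  have hTe : 0 ≤ T / e0 := div_nonneg hT he0.le
  have hB : (1 + 1 / e0) * T = T + T / e0 := by ring
  have hTB : T ≤ (1 + 1 / e0) * T := by linarith
  have hB0 : 0 ≤ (1 + 1 / e0) * T := hT.trans hTB
  have hjob : ∀ k, finish (A (σ k)) (prefLoad p σ (σ k) k + p k) ≤ (1 + 1 / e0) * T := by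
    intro k
    suffices ∃ i, prefLoad p σ i k + p k ≤ A i ((1 + 1 / e0) * T) by
      obtain ⟨i, hi⟩ := this
      exact (hECT k i).trans (finish_le hB0 hi)
    by_contra! hcon
    let l : Fin m := ⟨m - 1, by omega⟩
    have hlast : A l T < prefLoad p σ l k + p k :=
      (hmonoOn l hT hB0 hTB).trans_lt (hcon l)
    have hrest : ∀ i, i ≠ l → A i T ≤ prefLoad p σ i k := fun i hi => by
      have h := hAlo i (hlt i fun h => hi (Fin.ext h)) T _ hT hTB
      have he : e0 * ((1 + 1 / e0) * T - T) = T := by field_simp; ring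
      linarith [hcon i, hpT k]
    have hsum : ∑ i, A i T < ∑ i, prefLoad p σ i k + p k := by
      rw [← Finset.add_sum_erase _ _ (Finset.mem_univ l),
        ← Finset.add_sum_erase _ (fun i => prefLoad p σ i k) (Finset.mem_univ l)]
      have := Finset.sum_le_sum fun i (hi : i ∈ Finset.univ.erase l) =>
        hrest i (Finset.ne_of_mem_erase hi)
      linarith
    have hopt : ∑ j, p j ≤ ∑ i, A i T :=
      (sum_load p τ).symm.le.trans (Finset.sum_le_sum fun i _ => hload i)
    linarith [sum_prefLoad_add_le hp' σ k]
  refine Finset.sup'_le _ _ fun i _ => ?_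
  rcases load_eq_zero_or_eq_prefLoad_add p σ i with h | ⟨k, rfl, h⟩
  · rw [h]
    exact (finish_le le_rfl (hA0 i).ge).trans hB0
  · rw [h]
    exact hjob k
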